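/- Let (α_z)_{z∈ℂ} be an analytic one-parameter group on A relative to φ. Then for every z ∈ ℂ the map α_z : A → A is a bijective algebra automorphism, and its inverse is α_{-z}. -/

import Mathlib

open scoped ComplexOrder

/-- An analytic one-parameter group on a (not necessarily unital) complex `*`-algebra `A`,
relative to a linear functional `φ` : a family `(α z)_{z ∈ ℂ}` of algebra homomorphisms
`A → A` such that each `α t` (`t` real) is a `*`-automorphism, the real group law holds,
each real `α t` scales `φ` by a strictly positive constant, and all the functions
`z ↦ φ (b * α z a)` and `z ↦ φ (α z a * b)` are entire. -/
structure AnalyticOneParamGroup {A : Type*} [NonUnitalRing A] [Module ℂ A]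
    [SMulCommClass ℂ A A] [IsScalarTower ℂ A A] [StarRing A] [StarModule ℂ A]
    (φ : A →ₗ[ℂ] ℂ) (α : ℂ → A → A) : Prop where
  map_add : ∀ (z : ℂ) (a b : A), α z (a + b) = α z a + α z b
  map_smul : ∀ (z : ℂ) (c : ℂ) (a : A), α z (c • a) = c • α z a
  map_mul : ∀ (z : ℂ) (a b : A), α z (a * b) = α z a * α z b
  real_star : ∀ (t : ℝ) (a : A), α (t : ℂ) (star a) = star (α (t : ℂ) a)
  real_bijective : ∀ t : ℝ, Function.Bijective (α (t : ℂ))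
  real_group : ∀ (s t : ℝ) (a : A), α ((s : ℂ) + (t : ℂ)) a = α (s : ℂ) (α (t : ℂ) a)
  real_rel_invariant : ∀ t : ℝ, ∃ c : ℝ, 0 < c ∧ ∀ a : A, φ (α (t : ℂ) a) = (c : ℂ) * φ a
  entire_left : ∀ a b : A, Differentiable ℂ fun z : ℂ => φ (b * α z a)
  entire_right : ∀ a b : A, Differentiable ℂ fun z : ℂ => φ (α z a * b)

/-- Two entire functions that agree on the real line are equal. -/
theorem Differentiable.eq_of_eq_ofReal {f g : ℂ → ℂ} (hf : Differentiable ℂ f)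
    (hg : Differentiable ℂ g) (h : ∀ t : ℝ, f t = g t) : f = g := by
  refine AnalyticOnNhd.eq_of_frequently_eq (z₀ := 0) (fun z _ => hf.analyticAt z)
    (fun z _ => hg.analyticAt z) ?_
  have hmap : Filter.Tendsto ((↑) : ℝ → ℂ) (nhdsWithin 0 {0}ᶜ) (nhdsWithin 0 {0}ᶜ) := by
    refine tendsto_nhdsWithin_iff.2 ⟨?_, ?_⟩
    · exact (Complex.continuous_ofReal.tendsto' 0 0 Complex.ofReal_zero).mono_left
        nhdsWithin_le_nhds
    · filter_upwards [self_mem_nhdsWithin] with t ht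
      simpa using ht
  exact hmap.frequently (Filter.Frequently.of_forall h)

/-- A faithful functional separates points through left multiplication. -/
theorem eq_of_forall_apply_mul_left_eq {A : Type*} [NonUnitalRing A] [Module ℂ A]
    [StarRing A] (φ : A →ₗ[ℂ] ℂ) (hfaith : ∀ a : A, φ (star a * a) = 0 → a = 0) {x y : A}
    (h : ∀ b : A, φ (b * x) = φ (b * y)) : x = y := by
  refine sub_eq_zero.1 (hfaith _ ?_)
  rw [mul_sub, map_sub, h, sub_self]

namespace AnalyticOneParamGroup

variable {A : Type*} [NonUnitalRing A] [Module ℂ A] [SMulCommClass ℂ A A] [IsScalarTower ℂ A A]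
  [StarRing A] [StarModule ℂ A] {φ : A →ₗ[ℂ] ℂ} {α : ℂ → A → A}

theorem zero_apply (hα : AnalyticOneParamGroup φ α) (a : A) : α 0 a = a := by
  have hinj := (hα.real_bijective 0).injective
  have h := hα.real_group 0 0 a
  simp only [Complex.ofReal_zero, add_zero] at h hinj
  exact (hinj h).symm

theorem real_add_apply (hα : AnalyticOneParamGroup φ α)
    (hfaith : ∀ a : A, φ (star a * a) = 0 → a = 0) (s : ℝ) (z : ℂ) (a : A) :
    α (s + z) a = α s (α z a) := by
  refine eq_of_forall_apply_mul_left_eq φ hfaith fun b => ?_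
  obtain ⟨b, rfl⟩ := (hα.real_bijective s).surjective b
  obtain ⟨c, -, hc⟩ := hα.real_rel_invariant s
  rw [← hα.map_mul, hc]
  refine congrFun (Differentiable.eq_of_eq_ofReal
    (f := fun z => φ (α s b * α (s + z) a)) (g := fun z => c * φ (b * α z a))
    ((hα.entire_left a (α s b)).comp (differentiable_id.const_add (s : ℂ)))
    ((hα.entire_left a b).const_mul (c : ℂ)) fun t => ?_) z
  rw [hα.real_group, ← hα.map_mul, hc]

/-- The group law holds for complex parameters. -/
theorem add_apply (hα : AnalyticOneParamGroup φ α)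
    (hfaith : ∀ a : A, φ (star a * a) = 0 → a = 0) (w z : ℂ) (a : A) :
    α (w + z) a = α w (α z a) := by
  refine eq_of_forall_apply_mul_left_eq φ hfaith fun b => ?_
  refine congrFun (Differentiable.eq_of_eq_ofReal
    (f := fun w => φ (b * α (w + z) a)) (g := fun w => φ (b * α w (α z a)))
    ((hα.entire_left a b).comp (differentiable_id.add_const z))
    (hα.entire_left (α z a) b) fun t => ?_) w
  rw [hα.real_add_apply hfaith]

end AnalyticOneParamGroup

/-- Every `α z` of an analytic one-parameter group is a bijective algebra automorphism of `A`
with inverse `α (-z)`. -/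
theorem analyticOneParamGroup_bijective {A : Type*} [NonUnitalRing A] [Module ℂ A]
    [SMulCommClass ℂ A A] [IsScalarTower ℂ A A] [StarRing A] [StarModule ℂ A]
    (φ : A →ₗ[ℂ] ℂ)
    (hpos : ∀ a : A, 0 ≤ φ (star a * a))
    (hfaith : ∀ a : A, φ (star a * a) = 0 → a = 0)
    (α : ℂ → A → A) (hα : AnalyticOneParamGroup φ α)
    (z : ℂ) :
    Function.Bijective (α z) ∧ (∀ a : A, α (-z) (α z a) = a) ∧ (∀ a : A, α z (α (-z) a) = a) := by
  have h₁ : ∀ a : A, α (-z) (α z a) = a := fun a => by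
    rw [← hα.add_apply hfaith, neg_add_cancel, hα.zero_apply]
  have h₂ : ∀ a : A, α z (α (-z) a) = a := fun a => by
    rw [← hα.add_apply hfaith, add_neg_cancel, hα.zero_apply]
  exact ⟨⟨Function.LeftInverse.injective h₁, Function.RightInverse.surjective h₂⟩, h₁, h₂⟩
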